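/- Let ρ = (1/2)(|00⟩⟨00| + |++⟩⟨++|), where |+⟩ = (|0⟩+|1⟩)/√2 and |xy⟩ = |x⟩⊗|y⟩, and let Π_± = (1/2)(I₂ ± (σ₁+σ₃)/√2). Then Tr[ρ(Π_±⊗I₂)] = (1/2)(1 ± 1/√2) and Tr_A[ρ(Π_±⊗I₂)] = (1/2)(1 ± 1/√2) · ρ_B, where ρ_B = Tr_A ρ = (1/2)(I₂ + (1/2)σ₁ + (1/2)σ₃); i.e., both normalized conditional states of Bob equal the reduced state ρ_B. Consequently the Holevo quantity of this ensemble, χ = S(ρ_B) − Σ_± p_± S(ρ_{B|±}), vanishes. -/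

import Mathlib

open Matrix
open scoped Kronecker

noncomputable section

/-- Pauli matrices. -/
def σ1 : Matrix (Fin 2) (Fin 2) ℂ := !![0, 1; 1, 0]
def σ2 : Matrix (Fin 2) (Fin 2) ℂ := !![0, -Complex.I; Complex.I, 0]
def σ3 : Matrix (Fin 2) (Fin 2) ℂ := !![1, 0; 0, -1]

/-- The 2×2 identity. -/
def I₂ : Matrix (Fin 2) (Fin 2) ℂ := 1

/-- Partial trace over the first qubit: `(Tr_A N)_{j,j'} = Σᵢ N_{(i,j),(i,j')}`. -/
def trA (N : Matrix (Fin 2 × Fin 2) (Fin 2 × Fin 2) ℂ) : Matrix (Fin 2) (Fin 2) ℂ :=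
  fun j j' => ∑ i : Fin 2, N (i, j) (i, j')

/-- The rank-one projector `|v⟩⟨v|` on a qubit. -/
def proj2 (v : Fin 2 → ℂ) : Matrix (Fin 2) (Fin 2) ℂ := Matrix.vecMulVec v (star v)

/-- `|0⟩`, `|1⟩`, `|+⟩ = (|0⟩+|1⟩)/√2`. -/
def ket0 : Fin 2 → ℂ := ![1, 0]
def ket1 : Fin 2 → ℂ := ![0, 1]
def ketPlus : Fin 2 → ℂ := ![((1 / Real.sqrt 2 : ℝ) : ℂ), ((1 / Real.sqrt 2 : ℝ) : ℂ)]

/-- The binary entropy function. -/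
def binEnt (x : ℝ) : ℝ := -(x * Real.logb 2 x) - (1 - x) * Real.logb 2 (1 - x)

open Classical in
/-- The von Neumann entropy `S(ρ) = −Σ_μ μ log₂ μ` over the eigenvalues of `ρ`
(defined for Hermitian `ρ`; junk value `0` otherwise). -/
def vnEntropy (ρ : Matrix (Fin 2) (Fin 2) ℂ) : ℝ :=
  if h : ρ.IsHermitian then
    -(∑ j, h.eigenvalues j * Real.logb 2 (h.eigenvalues j))
  else 0

theorem proj2_ket0 : proj2 ket0 = !![1, 0; 0, 0] := by
  ext i j
  fin_cases i <;> fin_cases j <;> simp [proj2, ket0, vecMulVec_apply]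

theorem proj2_ketPlus : proj2 ketPlus = !![1/2, 1/2; 1/2, 1/2] := by
  have h : ((1 / Real.sqrt 2 : ℝ) : ℂ) * ((1 / Real.sqrt 2 : ℝ) : ℂ) = 1 / 2 := by
    rw [← Complex.ofReal_mul, div_mul_div_comm, Real.mul_self_sqrt zero_le_two]
    norm_num
  ext i j
  fin_cases i <;> fin_cases j <;>
    simpa [proj2, ketPlus, vecMulVec_apply, Complex.conj_ofReal] using h

theorem trace_trA (N : Matrix (Fin 2 × Fin 2) (Fin 2 × Fin 2) ℂ) :
    (trA N).trace = N.trace := by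
  simp only [trace, diag, trA, Fintype.sum_prod_type]
  exact Finset.sum_comm

theorem trA_add (M N : Matrix (Fin 2 × Fin 2) (Fin 2 × Fin 2) ℂ) :
    trA (M + N) = trA M + trA N := by
  ext j j'
  simp [trA, Finset.sum_add_distrib]

theorem trA_smul (c : ℂ) (N : Matrix (Fin 2 × Fin 2) (Fin 2 × Fin 2) ℂ) :
    trA (c • N) = c • trA N := by
  ext j j'
  simp [trA, mul_add]

theorem trA_kronecker (A B : Matrix (Fin 2) (Fin 2) ℂ) : trA (A ⊗ₖ B) = A.trace • B := by
  ext j j'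
  simp [trA, trace, add_mul]

/-- Measuring the first factor of an equal mixture of two product operators, when the effect has
the same weight on both first factors, leaves the second marginal unchanged up to that weight. -/
theorem trA_mixture_mul_kronecker {A A' B B' P : Matrix (Fin 2) (Fin 2) ℂ} {p : ℂ}
    (h : (A * P).trace = p) (h' : (A' * P).trace = p) :
    trA (((1/2 : ℂ) • (A ⊗ₖ B + A' ⊗ₖ B')) * (P ⊗ₖ I₂)) = p • ((1/2 : ℂ) • (B + B')) := by
  rw [smul_mul_assoc, add_mul, ← mul_kronecker_mul, ← mul_kronecker_mul, trA_smul, trA_add,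
    trA_kronecker, trA_kronecker, h, h', I₂, mul_one, mul_one, ← smul_add, smul_comm]

/-- For `ρ = (1/2)(|00⟩⟨00| + |++⟩⟨++|)` and the projectors
`Π_± = (1/2)(I₂ ± (σ₁+σ₃)/√2)` (sign `ε = ±1`):
`Tr[ρ(Π_±⊗I₂)] = (1/2)(1 ± 1/√2)` and `Tr_A[ρ(Π_±⊗I₂)] = (1/2)(1 ± 1/√2)·ρ_B`,
where `ρ_B = Tr_A ρ = (1/2)(I₂ + (1/2)σ₁ + (1/2)σ₃)`; i.e. both normalized
conditional states of Bob equal the reduced state `ρ_B`. Consequently the Holevo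
quantity `χ = S(ρ_B) − Σ_± p_± S(ρ_{B|±})` of this ensemble vanishes. -/
theorem stmt_15 :
    let ρ := (1/2 : ℂ) • (proj2 ket0 ⊗ₖ proj2 ket0 + proj2 ketPlus ⊗ₖ proj2 ketPlus)
    let ρB := (1/2 : ℂ) • (I₂ + ((1/2 : ℝ) : ℂ) • σ1 + ((1/2 : ℝ) : ℂ) • σ3)
    let Pmeas : ℝ → Matrix (Fin 2) (Fin 2) ℂ := fun ε =>
      (1/2 : ℂ) • (I₂ + (ε : ℂ) • (((Real.sqrt 2 : ℝ) : ℂ)⁻¹ • (σ1 + σ3)))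
    let pr : ℝ → ℝ := fun ε => (1/2) * (1 + ε / Real.sqrt 2)
    trA ρ = ρB ∧
    (∀ ε : ℝ, ε = 1 ∨ ε = -1 →
      (ρ * (Pmeas ε ⊗ₖ I₂)).trace = ((pr ε : ℝ) : ℂ) ∧
      trA (ρ * (Pmeas ε ⊗ₖ I₂)) = ((pr ε : ℝ) : ℂ) • ρB) ∧
    vnEntropy (trA ρ)
      - pr 1 * vnEntropy (((pr 1 : ℝ) : ℂ)⁻¹ • trA (ρ * (Pmeas 1 ⊗ₖ I₂)))
      - pr (-1) * vnEntropy (((pr (-1) : ℝ) : ℂ)⁻¹ • trA (ρ * (Pmeas (-1) ⊗ₖ I₂))) = 0 := by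
  intro ρ ρB Pmeas pr
  have hB : (1/2 : ℂ) • (proj2 ket0 + proj2 ketPlus) = ρB := by
    rw [proj2_ket0, proj2_ketPlus]
    ext i j
    fin_cases i <;> fin_cases j <;> norm_num [ρB, I₂, σ1, σ3]
  have hρ : trA ρ = ρB := by
    rw [← hB, trA_smul, trA_add, trA_kronecker, trA_kronecker, proj2_ket0, proj2_ketPlus]
    norm_num [trace_fin_two]
  have h0 (ε : ℝ) : (proj2 ket0 * Pmeas ε).trace = ((pr ε : ℝ) : ℂ) := by
    rw [proj2_ket0, trace_fin_two, mul_apply, mul_apply]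
    simp [Pmeas, pr, I₂, σ1, σ3]
    ring
  have hplus (ε : ℝ) : (proj2 ketPlus * Pmeas ε).trace = ((pr ε : ℝ) : ℂ) := by
    rw [proj2_ketPlus, trace_fin_two, mul_apply, mul_apply]
    simp [Pmeas, pr, I₂, σ1, σ3]
    ring
  have hcond (ε : ℝ) : trA (ρ * (Pmeas ε ⊗ₖ I₂)) = ((pr ε : ℝ) : ℂ) • ρB :=
    hB ▸ trA_mixture_mul_kronecker (h0 ε) (hplus ε)
  have hBtr : ρB.trace = 1 := by
    rw [← hB, proj2_ket0, proj2_ketPlus]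
    norm_num [trace_fin_two]
  have hsqrt : 1 < Real.sqrt 2 := Real.one_lt_sqrt_two
  have hinv : 1 / Real.sqrt 2 < 1 := (div_lt_one (by positivity)).2 hsqrt
  have hpos : pr 1 ≠ 0 := by
    simp only [pr]
    positivity
  have hneg : pr (-1) ≠ 0 := by
    simp only [pr, neg_div]
    linarith
  refine ⟨hρ, fun ε _ => ⟨?_, hcond ε⟩, ?_⟩
  · rw [← trace_trA, hcond, trace_smul, hBtr, smul_eq_mul, mul_one]
  · rw [hcond, hcond, hρ, inv_smul_smul₀ (Complex.ofReal_ne_zero.2 hpos),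
      inv_smul_smul₀ (Complex.ofReal_ne_zero.2 hneg)]
    simp only [pr]
    ring

end
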